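/- arXiv:2409.06552 — 5 statements merged into one kernel-verified Lean document; each statement's English description precedes it below -/
import Mathlib

section
/- Fix a tuple (n_1,…,n_p) of positive integers and c ∈ ℝ, and for each natural number N ≥ 2 set t_N = N·ln(√2·N) + c·N. Then, as N → ∞, ( ∏_{j=1}^p P_{n_j}(N) ) · exp( −t_N · ∑_{j=1}^p P'_{n_j}(N)/P_{n_j}(N) ) converges to exp( −(c + ln√2)·(n_1 + … + n_p) ). -/
open Polynomial Filter

/-- Dilated Chebyshev polynomials of the second kind: `P₀ = 1`, `P₁ = X`,
`P_{n+1} = X·P_n - P_{n-1}`. -/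
noncomputable def P : ℕ → Polynomial ℝ
  | 0 => 1
  | 1 => Polynomial.X
  | n + 2 => Polynomial.X * P (n + 1) - P n

theorem monic_P_and_natDegree_P (n : ℕ) : (P n).Monic ∧ (P n).natDegree = n := by
  induction n using Nat.twoStepInduction with
  | zero => simp [P]
  | one => simp [P, monic_X]
  | more n ih₀ ih₁ =>
    have hmonic : (X * P (n + 1)).Monic := monic_X.mul ih₁.1
    have hdeg : (X * P (n + 1)).natDegree = n + 2 := by
      rw [natDegree_X_mul ih₁.1.ne_zero, ih₁.2]
    have hlt : (P n).natDegree < (X * P (n + 1)).natDegree := by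
      rw [hdeg, ih₀.2]; omega
    rw [P]
    exact ⟨hmonic.sub_of_left (degree_lt_degree hlt),
      (natDegree_sub_eq_left_of_natDegree_lt hlt).trans hdeg⟩

theorem degree_X_mul_derivative_sub_lt (p : ℝ[X]) (hp : p ≠ 0) :
    (X * derivative p - C (p.natDegree : ℝ) * p).degree < p.degree := by
  rw [degree_eq_natDegree hp, degree_lt_iff_coeff_zero]
  intro m hm
  have hcoeff : (X * derivative p).coeff m = m * p.coeff m := by
    cases m with
    | zero => simp
    | succ m => rw [coeff_X_mul, coeff_derivative]; push_cast; ring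
  rw [coeff_sub, coeff_C_mul, hcoeff]
  rcases hm.eq_or_lt with h | h
  · rw [h, sub_self]
  · simp [coeff_eq_zero_of_natDegree_lt h]

theorem tendsto_mul_log_of_degree_lt {p q : ℝ[X]} (h : q.degree < p.degree) (a : ℝ) :
    Tendsto (fun x : ℝ => q.eval x / p.eval x * (Real.log x + a)) atTop (nhds 0) := by
  have hp : p ≠ 0 := by rintro rfl; simp at h
  have hbig : (fun x => (X * q).eval x) =O[atTop] fun x => p.eval x := by
    apply isBigO_atTop_of_degree_le
    by_cases hq : q = 0
    · simp [hq]
    · rw [degree_eq_natDegree (mul_ne_zero X_ne_zero hq), degree_eq_natDegree hp,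
        natDegree_X_mul hq]
      exact_mod_cast natDegree_lt_natDegree hq h
  have hlittle : (fun x : ℝ => Real.log x + a) =o[atTop] fun x : ℝ => x :=
    Real.isLittleO_log_id_atTop.add (Asymptotics.isLittleO_const_id_atTop a)
  refine (hbig.mul_isLittleO hlittle).tendsto_div_nhds_zero.congr' ?_
  filter_upwards [eventually_ne_atTop 0] with x hx
  rw [eval_mul, eval_X]
  by_cases hpx : p.eval x = 0
  · simp [hpx]
  · field_simp

theorem tendsto_eval_mul_exp {p : ℝ[X]} (hp : p.Monic) (a c : ℝ) (ha : 0 < a) :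
    Tendsto (fun x : ℝ => p.eval x *
        Real.exp (-(x * Real.log (a * x) + c * x) * (p.derivative.eval x / p.eval x)))
      atTop (nhds (Real.exp (-(c + Real.log a) * p.natDegree))) := by
  have hlead : Tendsto (fun x : ℝ => p.eval x / x ^ p.natDegree) atTop (nhds 1) := by
    have h := div_tendsto_atTop_leadingCoeff_div_of_degree_eq p (X ^ p.natDegree)
      (by rw [degree_X_pow, degree_eq_natDegree hp.ne_zero])
    simpa [hp.leadingCoeff] using h
  have hexp := (Real.continuous_exp.tendsto _).comp (tendsto_mul_log_of_degree_lt
    (degree_X_mul_derivative_sub_lt p hp.ne_zero) (Real.log a + c)).neg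
  have hlim := (hlead.mul hexp).mul_const (Real.exp (-(c + Real.log a) * p.natDegree))
  simp only [neg_zero, Real.exp_zero, one_mul] at hlim
  refine hlim.congr' ?_
  filter_upwards [eventually_gt_atTop 0, p.eventually_atTop_not_isRoot hp.ne_zero] with x hx hpx
  replace hpx : p.eval x ≠ 0 := hpx
  have hpow : x ^ p.natDegree = Real.exp (Real.log x * p.natDegree) := by
    rw [← Real.rpow_def_of_pos hx, Real.rpow_natCast]
  simp only [Function.comp_apply, eval_sub, eval_mul, eval_X, eval_C]
  rw [hpow, div_eq_mul_inv, ← Real.exp_neg, mul_assoc, mul_assoc, ← Real.exp_add,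
    ← Real.exp_add, Real.log_mul ha.ne' hx.ne']
  congr 2
  field_simp
  ring

/-- With `t_N = N·ln(√2·N) + cN`, the quantity `d_𝐧 e^{-t_N λ_𝐧}` converges to
`e^{-(c + ln √2)|𝐧|}` as `N → ∞`. -/
theorem dim_exp_tendsto (p : ℕ) (n : Fin p → ℕ) (hn : ∀ j, 0 < n j) (c : ℝ) :
    Tendsto
      (fun N : ℕ =>
        (∏ j, (P (n j)).eval (N : ℝ)) *
          Real.exp (-((N : ℝ) * Real.log (Real.sqrt 2 * N) + c * N) *
            ∑ j, ((P (n j)).derivative.eval (N : ℝ)) / ((P (n j)).eval (N : ℝ))))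
      atTop
      (nhds (Real.exp (-(c + Real.log (Real.sqrt 2)) * ∑ j, (n j : ℝ)))) := by
  simp only [Finset.mul_sum, Real.exp_sum, ← Finset.prod_mul_distrib]
  refine tendsto_finsetProd _ fun j _ => ?_
  obtain ⟨hmonic, hdeg⟩ := monic_P_and_natDegree_P (n j)
  have h := tendsto_eval_mul_exp hmonic (Real.sqrt 2) c (by positivity)
  rw [hdeg] at h
  exact h.comp tendsto_natCast_atTop_atTop
end

section
/- For every c ∈ ℝ, the measure η̂_c is a probability measure on ℝ and satisfies, for every n ∈ ℕ, ∫ P_n dη̂_c = e^{−nc} if n is even and ∫ P_n dη̂_c = 0 if n is odd. -/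
open MeasureTheory

/-- The standard semicircle distribution on `ℝ`, with Lebesgue density
`x ↦ (√(4-x²)/(2π))·1_{|x|<2}`. -/
noncomputable def nuSC : Measure ℝ :=
  volume.withDensity fun x =>
    ENNReal.ofReal (if |x| < 2 then Real.sqrt (4 - x ^ 2) / (2 * Real.pi) else 0)

/-- The measure `η̂_c = 1_{c≤0}(1-e^{2c})(δ_{γ_c} + δ_{-γ_c})/2 + (e^c γ_c/(γ_c²-x²))·ν_SC`,
where `γ_c = e^c + e^{-c}`. -/
noncomputable def etaHat (c : ℝ) : Measure ℝ :=
  ENNReal.ofReal ((if c ≤ 0 then 1 else 0) * (1 - Real.exp (2 * c)) / 2) •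
      (Measure.dirac (Real.exp c + Real.exp (-c)) +
        Measure.dirac (-(Real.exp c + Real.exp (-c)))) +
    nuSC.withDensity fun x =>
      ENNReal.ofReal (Real.exp c * (Real.exp c + Real.exp (-c)) /
        ((Real.exp c + Real.exp (-c)) ^ 2 - x ^ 2))

open Real Set

/-- The density of the absolutely continuous part of `etaHat c` with respect to `nuSC`. -/
noncomputable def etaWeight (c x : ℝ) : ℝ :=
  exp c * (exp c + exp (-c)) / ((exp c + exp (-c)) ^ 2 - x ^ 2)

/-- The integrand of the moments of `etaHat c` in the angular variable `x = 2 cos θ`. -/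
noncomputable def etaAngular (c : ℝ) (n : ℕ) (θ : ℝ) : ℝ :=
  sin θ * sin ((n + 1) * θ) * etaWeight c (2 * cos θ)

lemma exp_mul_exp_neg_self (c : ℝ) : exp c * exp (-c) = 1 := by
  rw [← exp_add]; simp

lemma four_le_gamma_sq (c : ℝ) : 4 ≤ (exp c + exp (-c)) ^ 2 := by
  nlinarith [exp_mul_exp_neg_self c, sq_nonneg (exp c - exp (-c))]

lemma measurable_etaWeight (c : ℝ) : Measurable (etaWeight c) := by
  unfold etaWeight; fun_prop

lemma etaWeight_nonneg (c : ℝ) {x : ℝ} (hx : |x| ≤ 2) : 0 ≤ etaWeight c x := by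
  have h := sq_le_sq' (abs_le.1 hx).1 (abs_le.1 hx).2
  have := four_le_gamma_sq c
  unfold etaWeight
  apply div_nonneg (by positivity) (by linarith)

lemma abs_two_mul_cos_le (θ : ℝ) : |2 * cos θ| ≤ 2 := by
  rw [abs_mul, abs_two]; linarith [abs_cos_le_one θ]

lemma sin_mul_eval_P (n : ℕ) (θ : ℝ) :
    sin θ * (P n).eval (2 * cos θ) = sin ((n + 1) * θ) := by
  induction n using Nat.twoStepInduction with
  | zero => simp [P]
  | one =>
    simp only [P, Polynomial.eval_X, Nat.cast_one]
    rw [show (1 + 1 : ℝ) * θ = 2 * θ by ring, sin_two_mul]; ring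
  | more n h0 h1 =>
    simp only [P, Polynomial.eval_sub, Polynomial.eval_mul, Polynomial.eval_X]
    push_cast at h1 ⊢
    rw [mul_sub, h0, mul_left_comm, h1]
    have e1 : ((n : ℝ) + 2 + 1) * θ = (n + 1 + 1) * θ + θ := by ring
    have e2 : ((n : ℝ) + 1) * θ = (n + 1 + 1) * θ - θ := by ring
    rw [e1, e2, sin_add, sin_sub]; ring

lemma eval_P_neg (n : ℕ) (x : ℝ) : (P n).eval (-x) = (-1) ^ n * (P n).eval x := by
  induction n using Nat.twoStepInduction with
  | zero => simp [P]
  | one => simp [P]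
  | more n h0 h1 =>
    simp only [P, Polynomial.eval_sub, Polynomial.eval_mul, Polynomial.eval_X]
    rw [h0, h1]; ring

lemma sub_mul_eval_P_gamma (n : ℕ) (c : ℝ) :
    (1 - exp (2 * c)) * (P n).eval (exp c + exp (-c)) = exp (-(n * c)) - exp ((n + 2) * c) := by
  induction n using Nat.twoStepInduction with
  | zero => simp [P]
  | one =>
    simp only [P, Polynomial.eval_X, Nat.cast_one, one_mul]
    have e1 : exp (2 * c) = exp c ^ 2 := by rw [← exp_nat_mul]; simp
    have e2 : exp ((1 + 2) * c) = exp c ^ 3 := by rw [← exp_nat_mul]; norm_num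
    rw [e1, e2]
    linear_combination (-exp c) * exp_mul_exp_neg_self c
  | more n h0 h1 =>
    simp only [P, Polynomial.eval_sub, Polynomial.eval_mul, Polynomial.eval_X]
    push_cast at h1 ⊢
    rw [mul_sub, h0, mul_left_comm, h1]
    simp only [add_mul, mul_sub, ← exp_add]
    ring_nf

lemma abs_sin_sq_mul_etaWeight_le (c θ : ℝ) :
    |sin θ ^ 2 * etaWeight c (2 * cos θ)| ≤ exp c * (exp c + exp (-c)) / 4 := by
  have hg := four_le_gamma_sq c
  have hs := sin_sq_add_cos_sq θ
  rw [abs_of_nonneg (mul_nonneg (sq_nonneg _) (etaWeight_nonneg c (abs_two_mul_cos_le θ)))]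
  unfold etaWeight
  set D := (exp c + exp (-c)) ^ 2 - (2 * cos θ) ^ 2
  have hD : 4 * sin θ ^ 2 ≤ D := by simp only [D]; nlinarith
  rcases (sq_nonneg (sin θ)).eq_or_lt with h | h
  · rw [← h]; simp only [zero_mul]; positivity
  · have hD0 : 0 < D := by linarith
    rw [← mul_div_assoc, div_le_div_iff₀ hD0 (by norm_num)]
    have : 0 < exp c * (exp c + exp (-c)) := by positivity
    nlinarith

lemma etaAngular_eq (c : ℝ) (n : ℕ) (θ : ℝ) :
    etaAngular c n θ = sin θ ^ 2 * etaWeight c (2 * cos θ) * (P n).eval (2 * cos θ) := by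
  rw [etaAngular, ← sin_mul_eval_P]; ring

lemma intervalIntegrable_etaAngular (c : ℝ) (n : ℕ) (a b : ℝ) :
    IntervalIntegrable (etaAngular c n) volume a b := by
  have h : IntervalIntegrable (fun θ => sin θ ^ 2 * etaWeight c (2 * cos θ)) volume a b := by
    rw [intervalIntegrable_iff]
    refine Measure.integrableOn_of_bounded (by simp [uIoc]) ?_
      (M := exp c * (exp c + exp (-c)) / 4) (.of_forall fun θ => abs_sin_sq_mul_etaWeight_le c θ)
    have := (measurable_etaWeight c).comp (measurable_cos.const_mul 2)
    exact ((measurable_sin.pow_const 2).mul this).aestronglyMeasurable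
  have h2 := h.mul_continuousOn (g := fun θ => (P n).eval (2 * cos θ)) (by fun_prop)
  simpa only [← etaAngular_eq] using h2

lemma abs_etaAngular_le {c : ℝ} (hc : c ≠ 0) (n : ℕ) (θ : ℝ) :
    |etaAngular c n θ| ≤
      exp c * (exp c + exp (-c)) / ((exp c + exp (-c)) ^ 2 - 4) := by
  have hpos : 0 < (exp c + exp (-c)) ^ 2 - 4 := by
    have h : exp c - exp (-c) ≠ 0 := by
      rw [sub_ne_zero]; intro h; exact hc (by linarith [exp_injective h])
    have := sq_pos_of_ne_zero h
    nlinarith [exp_mul_exp_neg_self c]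
  have hw : |etaWeight c (2 * cos θ)| ≤
      exp c * (exp c + exp (-c)) / ((exp c + exp (-c)) ^ 2 - 4) := by
    rw [abs_of_nonneg (etaWeight_nonneg c (abs_two_mul_cos_le θ))]
    unfold etaWeight
    gcongr
    nlinarith [cos_sq_le_one θ]
  rw [etaAngular, abs_mul, abs_mul]
  calc |sin θ| * |sin ((n + 1) * θ)| * |etaWeight c (2 * cos θ)|
      ≤ 1 * 1 * |etaWeight c (2 * cos θ)| := by
        gcongr
        · exact abs_sin_le_one _
        · exact abs_sin_le_one _
    _ ≤ _ := by simpa using hw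

lemma gamma_sq_sub_mul_etaAngular (c : ℝ) (n : ℕ) {θ : ℝ} (hθ : sin θ ≠ 0) :
    ((exp c + exp (-c)) ^ 2 - (2 * cos θ) ^ 2) * etaAngular c n θ =
      exp c * (exp c + exp (-c)) * (sin θ * sin ((n + 1) * θ)) := by
  have hD : (exp c + exp (-c)) ^ 2 - (2 * cos θ) ^ 2 ≠ 0 := by
    have := sq_pos_of_ne_zero hθ
    nlinarith [four_le_gamma_sq c, sin_sq_add_cos_sq θ]
  rw [etaAngular, etaWeight, mul_left_comm, mul_div_cancel₀ _ hD, mul_comm]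

lemma integral_sin_mul_sin_nat (n : ℕ) :
    ∫ θ in (0 : ℝ)..π, sin θ * sin ((n + 1) * θ) = if n = 0 then π / 2 else 0 := by
  split_ifs with h
  · subst h
    simp [← sq, integral_sin_sq]
  · have e : ∀ θ : ℝ, sin θ * sin ((n + 1) * θ) =
        (cos (n * θ) - cos ((n + 2) * θ)) / 2 := fun θ => by
      have h1 : (n : ℝ) * θ = (n + 1) * θ - θ := by ring
      have h2 : ((n : ℝ) + 2) * θ = (n + 1) * θ + θ := by ring
      rw [h1, h2, cos_sub, cos_add]; ring
    have h0 : (n : ℝ) ≠ 0 := by exact_mod_cast h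
    have h2 : (n : ℝ) + 2 ≠ 0 := by positivity
    have s2 : sin (((n : ℝ) + 2) * π) = 0 := by exact_mod_cast sin_nat_mul_pi (n + 2)
    simp only [e]
    rw [intervalIntegral.integral_div, intervalIntegral.integral_sub
      (Continuous.intervalIntegrable (by fun_prop) _ _)
      (Continuous.intervalIntegrable (by fun_prop) _ _)]
    simp [intervalIntegral.integral_comp_mul_left, h0, h2, s2]

lemma integral_congr_sin_ne_zero {f g : ℝ → ℝ} (h : ∀ θ, sin θ ≠ 0 → f θ = g θ) :
    ∫ θ in (0 : ℝ)..π, f θ = ∫ θ in (0 : ℝ)..π, g θ := by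
  rw [intervalIntegral.integral_of_le pi_nonneg, intervalIntegral.integral_of_le pi_nonneg,
    integral_Ioc_eq_integral_Ioo, integral_Ioc_eq_integral_Ioo]
  exact setIntegral_congr_fun measurableSet_Ioo
    fun θ hθ => h θ (sin_pos_of_pos_of_lt_pi hθ.1 hθ.2).ne'

lemma integral_etaAngular_two (c : ℝ) :
    ∫ θ in (0 : ℝ)..π, etaAngular c 2 θ =
      (exp c ^ 2 + exp (-c) ^ 2 + 1) * (∫ θ in (0 : ℝ)..π, etaAngular c 0 θ) -
        exp c * (exp c + exp (-c)) * (π / 2) := by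
  have h0 := integral_sin_mul_sin_nat 0
  rw [if_pos rfl] at h0
  rw [← h0, ← intervalIntegral.integral_const_mul, ← intervalIntegral.integral_const_mul,
    ← intervalIntegral.integral_sub ((intervalIntegrable_etaAngular c 0 _ _).const_mul _)
      (Continuous.intervalIntegrable (by fun_prop) _ _)]
  refine integral_congr_sin_ne_zero fun θ hθ => ?_
  rw [← gamma_sq_sub_mul_etaAngular c 0 hθ]
  have h := exp_mul_exp_neg_self c
  simp only [etaAngular_eq, P, Polynomial.eval_sub, Polynomial.eval_mul, Polynomial.eval_X,
    Polynomial.eval_one]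
  linear_combination (2 * sin θ ^ 2 * etaWeight c (2 * cos θ)) * h

lemma integral_etaAngular_add_four (c : ℝ) (n : ℕ) :
    ∫ θ in (0 : ℝ)..π, etaAngular c (n + 4) θ =
      (exp c ^ 2 + exp (-c) ^ 2) * (∫ θ in (0 : ℝ)..π, etaAngular c (n + 2) θ) -
        ∫ θ in (0 : ℝ)..π, etaAngular c n θ := by
  have h0 := integral_sin_mul_sin_nat (n + 2)
  rw [if_neg (by omega)] at h0
  have h1 : (∫ θ in (0 : ℝ)..π, etaAngular c (n + 4) θ) =
      ∫ θ in (0 : ℝ)..π, ((exp c ^ 2 + exp (-c) ^ 2) * etaAngular c (n + 2) θ -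
        etaAngular c n θ -
        exp c * (exp c + exp (-c)) * (sin θ * sin (((n + 2 : ℕ) + 1) * θ))) := by
    refine integral_congr_sin_ne_zero fun θ hθ => ?_
    rw [← gamma_sq_sub_mul_etaAngular c (n + 2) hθ]
    have h := exp_mul_exp_neg_self c
    simp only [etaAngular_eq, P, Polynomial.eval_sub, Polynomial.eval_mul, Polynomial.eval_X]
    linear_combination (2 * sin θ ^ 2 * etaWeight c (2 * cos θ) *
      (2 * cos θ * (P (n + 1)).eval (2 * cos θ) - (P n).eval (2 * cos θ))) * h
  rw [h1, intervalIntegral.integral_sub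
    (((intervalIntegrable_etaAngular c _ _ _).const_mul _).sub
      (intervalIntegrable_etaAngular c _ _ _)) (Continuous.intervalIntegrable (by fun_prop) _ _),
    intervalIntegral.integral_sub ((intervalIntegrable_etaAngular c _ _ _).const_mul _)
      (intervalIntegrable_etaAngular c _ _ _),
    intervalIntegral.integral_const_mul, intervalIntegral.integral_const_mul, h0]
  ring

/-- A bounded solution of `b (m + 2) = (r + s) b (m + 1) - b m` with `r s = 1` and `1 < s`
is a multiple of the geometric sequence of ratio `r`. -/
lemma succ_eq_mul_of_bounded_recurrence {b : ℕ → ℝ} {r s C : ℝ} (hrs : r * s = 1) (hs : 1 < s)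
    (hb : ∀ m, |b m| ≤ C) (hrec : ∀ m, b (m + 2) = (r + s) * b (m + 1) - b m) (m : ℕ) :
    b (m + 1) = r * b m := by
  have hr0 : 0 < r := pos_of_mul_pos_left (by rw [hrs]; exact one_pos) (by linarith)
  have hD : ∀ k, b (m + k + 1) - r * b (m + k) = s ^ k * (b (m + 1) - r * b m) := by
    intro k
    induction k with
    | zero => simp
    | succ k ih =>
      rw [pow_succ, mul_right_comm, ← ih, ← add_assoc, hrec]
      linear_combination b (m + k) * hrs
  by_contra hne
  have hpos : 0 < |b (m + 1) - r * b m| := abs_pos.2 (sub_ne_zero.2 hne)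
  obtain ⟨k, hk⟩ := pow_unbounded_of_one_lt ((C + r * C) / |b (m + 1) - r * b m|) hs
  rw [div_lt_iff₀ hpos] at hk
  have h1 : |b (m + k + 1) - r * b (m + k)| ≤ C + r * C := by
    refine (abs_sub _ _).trans (add_le_add (hb _) ?_)
    rw [abs_mul, abs_of_pos hr0]
    exact mul_le_mul_of_nonneg_left (hb _) hr0.le
  rw [hD, abs_mul, abs_of_pos (by positivity : 0 < s ^ k)] at h1
  linarith

lemma integral_etaAngular_geometric {c r s : ℝ} (hc : c ≠ 0) (hrs : r * s = 1) (hs : 1 < s)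
    (hsum : r + s = exp c ^ 2 + exp (-c) ^ 2) (m : ℕ) :
    ∫ θ in (0 : ℝ)..π, etaAngular c (2 * m) θ =
      exp c * (exp c + exp (-c)) * (π / 2) / (1 + s) * r ^ m := by
  set b : ℕ → ℝ := fun m => ∫ θ in (0 : ℝ)..π, etaAngular c (2 * m) θ
  have hstep : ∀ m, b (m + 1) = r * b m :=
    succ_eq_mul_of_bounded_recurrence hrs hs
      (fun m => (norm_eq_abs (b m)).symm.trans_le
        (intervalIntegral.norm_integral_le_of_norm_le_const
          fun θ _ => abs_etaAngular_le hc (2 * m) θ))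
      (fun m => by rw [hsum]; exact integral_etaAngular_add_four c (2 * m))
  have h0 : b 0 = exp c * (exp c + exp (-c)) * (π / 2) / (1 + s) := by
    have h2 : b 1 = _ := integral_etaAngular_two c
    rw [← hsum] at h2
    change b 1 = (r + s + 1) * b 0 - _ at h2
    rw [eq_div_iff (by linarith)]
    linear_combination hstep 0 - h2
  change b m = _
  induction m with
  | zero => simp [h0]
  | succ m ih => rw [hstep, ih, pow_succ]; ring

lemma integral_etaAngular_zero_zero : ∫ θ in (0 : ℝ)..π, etaAngular 0 0 θ = π / 2 := by
  rw [integral_congr_sin_ne_zero (g := fun _ => 1 / 2)]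
  · simp; ring
  · intro θ hθ
    have h := gamma_sq_sub_mul_etaAngular 0 0 hθ
    have e : ((1 : ℝ) + 1) ^ 2 - (2 * cos θ) ^ 2 = 4 * sin θ ^ 2 := by
      linear_combination (-4) * sin_sq_add_cos_sq θ
    simp only [neg_zero, exp_zero, e, Nat.cast_zero, zero_add, one_mul] at h
    apply mul_left_cancel₀ (mul_pos four_pos (sq_pos_of_ne_zero hθ)).ne'
    linear_combination h

lemma integral_etaAngular_even_zero (m : ℕ) :
    ∫ θ in (0 : ℝ)..π, etaAngular 0 (2 * m) θ = π / 2 := by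
  induction m using Nat.twoStepInduction with
  | zero => exact integral_etaAngular_zero_zero
  | one =>
    rw [mul_one, integral_etaAngular_two, integral_etaAngular_zero_zero]
    simp; ring
  | more m h0 h1 =>
    rw [mul_add] at h1
    rw [show 2 * (m + 2) = 2 * m + 4 by ring, integral_etaAngular_add_four, h0, h1]
    simp; ring

lemma integral_etaAngular_even (c : ℝ) (m : ℕ) :
    2 / π * ∫ θ in (0 : ℝ)..π, etaAngular c (2 * m) θ =
      if c ≤ 0 then exp ((2 * m + 2) * c) else exp (-(2 * m * c)) := by
  have h := exp_mul_exp_neg_self c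
  rcases lt_trichotomy c 0 with hc | rfl | hc
  · rw [if_pos hc.le, integral_etaAngular_geometric (r := exp c ^ 2) (s := exp (-c) ^ 2) hc.ne
      (by rw [← mul_pow, h, one_pow])
      (one_lt_pow₀ (one_lt_exp_iff.2 (by linarith)) two_ne_zero) rfl]
    have e : exp ((2 * m + 2) * c) = exp c ^ 2 * (exp c ^ 2) ^ m := by
      rw [← pow_mul, ← pow_add, ← exp_nat_mul]; push_cast; ring_nf
    rw [e]
    field_simp
    linear_combination (-exp (-c)) * h
  · simp only [integral_etaAngular_even_zero, le_refl, if_true, mul_zero, exp_zero]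
    field_simp
  · rw [if_neg hc.not_ge, integral_etaAngular_geometric (r := exp (-c) ^ 2) (s := exp c ^ 2) hc.ne'
      (by rw [← mul_pow, mul_comm, h, one_pow])
      (one_lt_pow₀ (one_lt_exp_iff.2 hc) two_ne_zero) (add_comm _ _)]
    have e : exp (-(2 * m * c)) = (exp (-c) ^ 2) ^ m := by
      rw [← pow_mul, ← exp_nat_mul]; push_cast; ring_nf
    rw [e]
    field_simp
    linear_combination h

lemma integral_etaAngular_odd (c : ℝ) {n : ℕ} (hn : Odd n) :
    ∫ θ in (0 : ℝ)..π, etaAngular c n θ = 0 := by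
  have h := intervalIntegral.integral_comp_sub_left (a := 0) (b := π) (etaAngular c n) π
  have e : ∀ θ, etaAngular c n (π - θ) = -etaAngular c n θ := fun θ => by
    simp only [etaAngular_eq, sin_pi_sub, cos_pi_sub, mul_neg, eval_P_neg, hn.neg_one_pow,
      etaWeight, neg_sq]
    ring
  simp only [e, intervalIntegral.integral_neg, sub_self, sub_zero] at h
  linarith

lemma image_two_mul_cos_Ioo : (fun θ => 2 * cos θ) '' Ioo 0 π = {x | |x| < 2} := by
  ext x
  simp only [mem_image, mem_Ioo, mem_ofPred_eq, abs_lt]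
  constructor
  · rintro ⟨θ, ⟨h0, h1⟩, rfl⟩
    have := sin_pos_of_pos_of_lt_pi h0 h1
    constructor <;> nlinarith [sin_sq_add_cos_sq θ]
  · rintro ⟨h0, h1⟩
    refine ⟨arccos (x / 2), ⟨arccos_pos.2 (by linarith), ?_⟩, ?_⟩
    · exact (arccos_le_pi _).lt_of_ne fun h => by
        rw [arccos_eq_pi] at h; linarith
    · rw [cos_arccos (by linarith) (by linarith)]; ring

/-- The Lebesgue density of the semicircle distribution. -/
noncomputable def semicircleDensity (x : ℝ) : ℝ :=
  if |x| < 2 then √(4 - x ^ 2) / (2 * π) else 0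

lemma measurable_semicircleDensity : Measurable semicircleDensity :=
  Measurable.ite (measurableSet_lt (by fun_prop) (by fun_prop)) (by fun_prop) (by fun_prop)

lemma semicircleDensity_nonneg (x : ℝ) : 0 ≤ semicircleDensity x := by
  unfold semicircleDensity; split_ifs <;> positivity

lemma toReal_density_smul_eq_indicator (c : ℝ) (f : ℝ → ℝ) :
    (fun x => (ENNReal.ofReal (semicircleDensity x)).toReal •
      (ENNReal.ofReal (etaWeight c x)).toReal • f x) =
    {x : ℝ | |x| < 2}.indicator fun x => √(4 - x ^ 2) / (2 * π) * (etaWeight c x * f x) := by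
  ext x
  rw [ENNReal.toReal_ofReal (semicircleDensity_nonneg x)]
  by_cases hx : |x| < 2
  · rw [indicator_of_mem (by exact hx), ENNReal.toReal_ofReal (etaWeight_nonneg c hx.le),
      semicircleDensity, if_pos hx, smul_eq_mul, smul_eq_mul]
  · rw [indicator_of_notMem (by exact hx), semicircleDensity, if_neg hx, zero_smul]

lemma hasDerivWithinAt_two_mul_cos (s : Set ℝ) (θ : ℝ) :
    HasDerivWithinAt (fun θ => 2 * cos θ) (2 * -sin θ) s θ :=
  ((hasDerivAt_cos θ).const_mul 2).hasDerivWithinAt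

lemma injOn_two_mul_cos : InjOn (fun θ => 2 * cos θ) (Ioo 0 π) := fun x hx y hy h =>
  injOn_cos (Ioo_subset_Icc_self hx) (Ioo_subset_Icc_self hy) (by simpa using h)

lemma abs_deriv_smul_density (c : ℝ) (n : ℕ) : EqOn
    (fun θ => |2 * -sin θ| • (√(4 - (2 * cos θ) ^ 2) / (2 * π) *
      (etaWeight c (2 * cos θ) * (P n).eval (2 * cos θ))))
    (fun θ => 2 / π * etaAngular c n θ) (Ioo 0 π) := fun θ hθ => by
  have hs := sin_pos_of_pos_of_lt_pi hθ.1 hθ.2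
  have e : 4 - (2 * cos θ) ^ 2 = (2 * sin θ) ^ 2 := by
    linear_combination (-4) * sin_sq_add_cos_sq θ
  simp only [smul_eq_mul, etaAngular_eq]
  rw [e, sqrt_sq (by positivity), mul_neg, abs_neg, abs_of_pos (by positivity)]
  field_simp

/-- The absolutely continuous part of `etaHat c`. -/
noncomputable def etaContinuousPart (c : ℝ) : Measure ℝ :=
  nuSC.withDensity fun x => ENNReal.ofReal (etaWeight c x)

lemma measurableSet_abs_lt_two : MeasurableSet {x : ℝ | |x| < 2} :=
  measurableSet_lt (by fun_prop) (by fun_prop)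

lemma integrable_eval_P_etaContinuousPart (c : ℝ) (n : ℕ) :
    Integrable (fun x => (P n).eval x) (etaContinuousPart c) := by
  rw [etaContinuousPart, integrable_withDensity_iff_integrable_smul'
    (measurable_etaWeight c).ennreal_ofReal (by simp)]
  change Integrable _ (volume.withDensity fun x => ENNReal.ofReal (semicircleDensity x))
  rw [integrable_withDensity_iff_integrable_smul'
    measurable_semicircleDensity.ennreal_ofReal (by simp), toReal_density_smul_eq_indicator,
    integrable_indicator_iff measurableSet_abs_lt_two, ← image_two_mul_cos_Ioo,
    integrableOn_image_iff_integrableOn_abs_deriv_smul measurableSet_Ioo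
      (fun θ _ => hasDerivWithinAt_two_mul_cos _ θ) injOn_two_mul_cos,
    integrableOn_congr_fun (abs_deriv_smul_density c n) measurableSet_Ioo]
  have := (intervalIntegrable_etaAngular c n 0 π).const_mul (2 / π)
  rwa [intervalIntegrable_iff_integrableOn_Ioo_of_le pi_nonneg] at this

lemma integral_eval_P_etaContinuousPart (c : ℝ) (n : ℕ) :
    ∫ x, (P n).eval x ∂(etaContinuousPart c) =
      2 / π * ∫ θ in (0 : ℝ)..π, etaAngular c n θ := by
  rw [etaContinuousPart, integral_withDensity_eq_integral_toReal_smul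
    (measurable_etaWeight c).ennreal_ofReal (by simp)]
  change ∫ x, _ ∂(volume.withDensity fun x => ENNReal.ofReal (semicircleDensity x)) = _
  rw [integral_withDensity_eq_integral_toReal_smul
    measurable_semicircleDensity.ennreal_ofReal (by simp), toReal_density_smul_eq_indicator,
    integral_indicator measurableSet_abs_lt_two, ← image_two_mul_cos_Ioo,
    integral_image_eq_integral_abs_deriv_smul measurableSet_Ioo
      (fun θ _ => hasDerivWithinAt_two_mul_cos _ θ) injOn_two_mul_cos,
    setIntegral_congr_fun measurableSet_Ioo (abs_deriv_smul_density c n),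
    intervalIntegral.integral_of_le pi_nonneg, integral_Ioc_eq_integral_Ioo, integral_const_mul]

lemma integral_eval_P_etaHat (c : ℝ) (n : ℕ) :
    ∫ x, (P n).eval x ∂(etaHat c) = if Even n then exp (-(n * c)) else 0 := by
  have hd : ∀ a : ℝ, Integrable (fun x => (P n).eval x) (Measure.dirac a) :=
    fun a => integrable_dirac (by simp)
  have hw : 0 ≤ (if c ≤ 0 then 1 else 0) * (1 - exp (2 * c)) / 2 := by
    split_ifs with hc
    · have : exp (2 * c) ≤ 1 := exp_le_one_iff.2 (by linarith)
      linarith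
    · simp
  change ∫ x, _ ∂(_ + etaContinuousPart c) = _
  rw [integral_add_measure (((hd _).add_measure (hd _)).smul_measure ENNReal.ofReal_ne_top)
    (integrable_eval_P_etaContinuousPart c n), integral_smul_measure,
    integral_add_measure (hd _) (hd _), integral_dirac, integral_dirac,
    integral_eval_P_etaContinuousPart, ENNReal.toReal_ofReal hw, eval_P_neg, smul_eq_mul]
  by_cases hn : Even n
  · obtain ⟨m, rfl⟩ := hn.two_dvd
    rw [if_pos hn, integral_etaAngular_even, hn.neg_one_pow]
    split_ifs
    · have h := sub_mul_eval_P_gamma (2 * m) c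
      push_cast at h ⊢
      linear_combination h
    · push_cast
      ring
  · rw [if_neg hn, integral_etaAngular_odd c (Nat.not_even_iff_odd.1 hn),
      (Nat.not_even_iff_odd.1 hn).neg_one_pow]
    ring

/-- `η̂_c` is a probability measure with `∫ P_n dη̂_c = e^{-nc}` if `n` is even and `0` if `n`
is odd. -/
theorem etaHat_moments (c : ℝ) :
    IsProbabilityMeasure (etaHat c) ∧
    ∀ n : ℕ, (∫ x, (P n).eval x ∂(etaHat c)) =
      if Even n then Real.exp (-(n * c)) else 0 := by
  refine ⟨⟨?_⟩, integral_eval_P_etaHat c⟩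
  rw [← ENNReal.toReal_eq_one_iff]
  simpa [P, Measure.real] using integral_eval_P_etaHat c 0
end

section
/- For every c ∈ ℝ and every n ∈ ℕ, the measure η_c is a probability measure on ℝ and satisfies ∫ P_n dη_c = e^{−cn}. -/
open MeasureTheory

/-- The measure `η_c = 1_{c<0}(1-e^{2c})·δ_{γ_c} + (e^c √(4-x²) 1_{|x|<2}/(2π(γ_c - x)))·dx`,
where `γ_c = e^c + e^{-c}` (shifted free Meixner law `Meix(-e^{-c},0) * δ_{e^{-c}}`). -/
noncomputable def eta (c : ℝ) : Measure ℝ :=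
  ENNReal.ofReal ((if c < 0 then 1 else 0) * (1 - Real.exp (2 * c))) •
      Measure.dirac (Real.exp c + Real.exp (-c)) +
    volume.withDensity fun x =>
      ENNReal.ofReal (Real.exp c * Real.sqrt (4 - x ^ 2) * (if |x| < 2 then 1 else 0) /
        (2 * Real.pi * ((Real.exp c + Real.exp (-c)) - x)))

/-- The defining property `P_n(2 cos θ) sin θ = sin ((n + 1) θ)` of the second kind. -/
lemma eval_P_two_mul_cos_mul_sin (n : ℕ) (θ : ℝ) :
    (P n).eval (2 * Real.cos θ) * Real.sin θ = Real.sin ((n + 1 : ℕ) * θ) := by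
  induction n using Nat.twoStepInduction with
  | zero => simp [P]
  | one => simp [P, Real.sin_two_mul]; ring
  | more n ih₀ ih₁ =>
    have hadd : Real.sin ((n + 2 + 1 : ℕ) * θ) + Real.sin ((n + 1 : ℕ) * θ) =
        2 * Real.cos θ * Real.sin ((n + 1 + 1 : ℕ) * θ) := by
      rw [show ((n + 2 + 1 : ℕ) : ℝ) * θ = (n + 1 + 1 : ℕ) * θ + θ by push_cast; ring,
        show ((n + 1 : ℕ) : ℝ) * θ = (n + 1 + 1 : ℕ) * θ - θ by push_cast; ring,
        Real.sin_add, Real.sin_sub]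
      ring
    simp only [P, Polynomial.eval_sub, Polynomial.eval_mul, Polynomial.eval_X]
    linear_combination 2 * Real.cos θ * ih₁ - ih₀ - hadd

lemma eval_P_add_inv_mul {r : ℝ} (hr : r ≠ 0) (n : ℕ) :
    (P n).eval (r + r⁻¹) * (r⁻¹ - r) = r⁻¹ ^ (n + 1) - r ^ (n + 1) := by
  have h : r * r⁻¹ = 1 := mul_inv_cancel₀ hr
  induction n using Nat.twoStepInduction with
  | zero => simp [P]
  | one => simp only [P, Polynomial.eval_X]; ring
  | more n ih₀ ih₁ =>
    simp only [P, Polynomial.eval_sub, Polynomial.eval_mul, Polynomial.eval_X]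
    linear_combination (r + r⁻¹) * ih₁ - ih₀ + (r⁻¹ ^ (n + 1) - r ^ (n + 1)) * h

lemma abs_sin_natCast_mul_le (n : ℕ) (θ : ℝ) : |Real.sin (n * θ)| ≤ n * |Real.sin θ| := by
  induction n with
  | zero => simp
  | succ n ih =>
    rw [Nat.cast_succ, add_mul, one_mul, Real.sin_add]
    calc _ ≤ |Real.sin (n * θ)| * |Real.cos θ| + |Real.cos (n * θ)| * |Real.sin θ| := by
          simpa only [abs_mul] using
            abs_add_le (Real.sin (n * θ) * Real.cos θ) (Real.cos (n * θ) * Real.sin θ)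
      _ ≤ |Real.sin (n * θ)| * 1 + 1 * |Real.sin θ| := by
          gcongr <;> exact Real.abs_cos_le_one _
      _ ≤ _ := by linarith

/-- The Fourier sine integrand of `θ ↦ sin θ / (g - 2 cos θ)`. -/
noncomputable def sineKernel (g : ℝ) (n : ℕ) (θ : ℝ) : ℝ :=
  Real.sin θ * Real.sin (n * θ) / (g - 2 * Real.cos θ)

lemma norm_sineKernel_le {g : ℝ} (hg : 2 ≤ g) (n : ℕ) (θ : ℝ) : ‖sineKernel g n θ‖ ≤ n := by
  have h0 : 0 ≤ g - 2 * Real.cos θ := by linarith [Real.cos_le_one θ]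
  rw [sineKernel, Real.norm_eq_abs, abs_div, abs_mul, abs_of_nonneg h0]
  refine div_le_of_le_mul₀ h0 n.cast_nonneg ?_
  calc |Real.sin θ| * |Real.sin (n * θ)| ≤ |Real.sin θ| * (n * |Real.sin θ|) := by
        gcongr; exact abs_sin_natCast_mul_le n θ
    _ = n * Real.sin θ ^ 2 := by rw [← sq_abs]; ring
    _ ≤ n * (g - 2 * Real.cos θ) := by
        gcongr
        nlinarith [Real.sin_sq_add_cos_sq θ, sq_nonneg (1 - Real.cos θ)]

lemma intervalIntegrable_sineKernel {g : ℝ} (hg : 2 ≤ g) (n : ℕ) (a b : ℝ) :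
    IntervalIntegrable (sineKernel g n) volume a b := by
  refine (intervalIntegrable_const (c := (n : ℝ))).mono_fun ?_ ?_
  · refine Measurable.aestronglyMeasurable ?_
    unfold sineKernel
    fun_prop
  · exact .of_forall fun θ => by
      simpa using norm_sineKernel_le hg n θ

lemma integral_cos_natCast_mul {k : ℕ} (hk : k ≠ 0) :
    ∫ θ in (0 : ℝ)..Real.pi, Real.cos (k * θ) = 0 := by
  rw [intervalIntegral.integral_comp_mul_left Real.cos (Nat.cast_ne_zero.2 hk)]
  simp [Real.sin_nat_mul_pi]

lemma integral_sin_mul_sin_natCast_mul (n : ℕ) :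
    ∫ θ in (0 : ℝ)..Real.pi, Real.sin θ * Real.sin ((n + 1 : ℕ) * θ) =
      if n = 0 then Real.pi / 2 else 0 := by
  have h : ∀ θ : ℝ, Real.sin θ * Real.sin ((n + 1 : ℕ) * θ) =
      2⁻¹ * (Real.cos (n * θ) - Real.cos ((n + 2 : ℕ) * θ)) := fun θ => by
    rw [show (n : ℝ) * θ = (n + 1 : ℕ) * θ - θ by push_cast; ring,
      show ((n + 2 : ℕ) : ℝ) * θ = (n + 1 : ℕ) * θ + θ by push_cast; ring,
      Real.cos_add, Real.cos_sub]
    ring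
  simp_rw [h]
  rw [intervalIntegral.integral_const_mul, intervalIntegral.integral_sub
    (Continuous.intervalIntegrable (by fun_prop) _ _)
    (Continuous.intervalIntegrable (by fun_prop) _ _),
    integral_cos_natCast_mul (Nat.succ_ne_zero (n + 1))]
  split_ifs with hn
  · subst hn
    simp; ring
  · simp [integral_cos_natCast_mul hn]

lemma integral_sineKernel_add_two {g : ℝ} (hg : 2 ≤ g) (n : ℕ) :
    ∫ θ in (0 : ℝ)..Real.pi, sineKernel g (n + 2) θ =
      g * (∫ θ in (0 : ℝ)..Real.pi, sineKernel g (n + 1) θ) -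
        (∫ θ in (0 : ℝ)..Real.pi, sineKernel g n θ) - if n = 0 then Real.pi / 2 else 0 := by
  have hI := fun k => intervalIntegrable_sineKernel hg k 0 Real.pi
  rw [← integral_sin_mul_sin_natCast_mul, ← intervalIntegral.integral_const_mul,
    ← intervalIntegral.integral_sub ((hI _).const_mul _) (hI _),
    ← intervalIntegral.integral_sub (((hI _).const_mul _).sub (hI _))
      (Continuous.intervalIntegrable (by fun_prop) _ _)]
  refine intervalIntegral.integral_congr_ae (.of_forall fun θ hθ => ?_)
  rw [Set.uIoc_of_le Real.pi_pos.le] at hθ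
  have hcos : Real.cos θ < 1 := by
    simpa using Real.cos_lt_cos_of_nonneg_of_le_pi le_rfl hθ.2 hθ.1
  have h0 : g - 2 * Real.cos θ ≠ 0 := by linarith
  have hadd : Real.sin ((n + 2 : ℕ) * θ) + Real.sin (n * θ) =
      2 * Real.cos θ * Real.sin ((n + 1 : ℕ) * θ) := by
    rw [show ((n + 2 : ℕ) : ℝ) * θ = (n + 1 : ℕ) * θ + θ by push_cast; ring,
      show (n : ℝ) * θ = (n + 1 : ℕ) * θ - θ by push_cast; ring,
      Real.sin_add, Real.sin_sub]
    ring
  simp only [sineKernel]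
  rw [← sub_eq_zero, eq_sub_of_add_eq hadd]
  field_simp
  ring

lemma two_le_add_inv {r : ℝ} (hr : 0 < r) : 2 ≤ r + r⁻¹ := by
  have h : r * r⁻¹ = 1 := mul_inv_cancel₀ hr.ne'
  nlinarith [sq_nonneg (r - r⁻¹), inv_pos.2 hr]

lemma integral_sineKernel_two_one :
    ∫ θ in (0 : ℝ)..Real.pi, sineKernel 2 1 θ = Real.pi / 2 := by
  calc _ = ∫ θ in (0 : ℝ)..Real.pi, 2⁻¹ * (1 + Real.cos θ) := by
        refine intervalIntegral.integral_congr_ae (.of_forall fun θ hθ => ?_)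
        rw [Set.uIoc_of_le Real.pi_pos.le] at hθ
        have hcos : Real.cos θ < 1 := by
          simpa using Real.cos_lt_cos_of_nonneg_of_le_pi le_rfl hθ.2 hθ.1
        have h0 : 2 - 2 * Real.cos θ ≠ 0 := by linarith
        rw [sineKernel, div_eq_iff h0, Nat.cast_one, one_mul]
        linear_combination Real.sin_sq_add_cos_sq θ
    _ = Real.pi / 2 := by
        rw [intervalIntegral.integral_const_mul, intervalIntegral.integral_add
          (Continuous.intervalIntegrable (by fun_prop) _ _)
          (Continuous.intervalIntegrable (by fun_prop) _ _)]
        simp; ring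

lemma integral_sineKernel_one {r : ℝ} (hr : 0 < r) (hr1 : r ≤ 1) :
    ∫ θ in (0 : ℝ)..Real.pi, sineKernel (r + r⁻¹) 1 θ = Real.pi / 2 * r := by
  rcases hr1.eq_or_lt with rfl | hr1
  · rw [inv_one, one_add_one_eq_two, integral_sineKernel_two_one, mul_one]
  set S : ℕ → ℝ := fun n => ∫ θ in (0 : ℝ)..Real.pi, sineKernel (r + r⁻¹) n θ with hS
  have hg := two_le_add_inv hr
  have hinv : r * r⁻¹ = 1 := mul_inv_cancel₀ hr.ne'
  have hrec : ∀ n, S (n + 2) = (r + r⁻¹) * S (n + 1) - S n - if n = 0 then Real.pi / 2 else 0 :=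
    integral_sineKernel_add_two hg
  have hbound : ∀ n, |S n| ≤ n * Real.pi := fun n => by
    have := intervalIntegral.norm_integral_le_of_norm_le_const (a := 0) (b := Real.pi)
      (fun θ _ => norm_sineKernel_le hg n θ)
    simpa [abs_of_pos Real.pi_pos] using this
  have hD : ∀ n : ℕ, r ^ n * (S (n + 2) - r * S (n + 1)) = S 2 - r * S 1 := fun n => by
    induction n with
    | zero => simp
    | succ n ih =>
      rw [← ih, hrec (n + 1), if_neg n.succ_ne_zero]
      linear_combination r ^ n * S (n + 1 + 1) * hinv
  have hlim : Filter.Tendsto (fun n : ℕ => r ^ n * (S (n + 2) - r * S (n + 1))) Filter.atTop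
      (nhds 0) := by
    have h1 : Filter.Tendsto (fun n : ℕ => 2 * Real.pi * (n * r ^ n) + 3 * Real.pi * r ^ n)
        Filter.atTop (nhds 0) := by
      simpa using ((tendsto_self_mul_const_pow_of_lt_one hr.le hr1).const_mul (2 * Real.pi)).add
        ((tendsto_pow_atTop_nhds_zero_of_lt_one hr.le hr1).const_mul (3 * Real.pi))
    refine squeeze_zero_norm (fun n => ?_) h1
    rw [norm_mul, Real.norm_of_nonneg (pow_nonneg hr.le n), Real.norm_eq_abs]
    have h2 : |S (n + 2) - r * S (n + 1)| ≤ (2 * n + 3) * Real.pi := by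
      have h3 := abs_sub (S (n + 2)) (r * S (n + 1))
      rw [abs_mul, abs_of_pos hr] at h3
      have h4 := hbound (n + 2)
      have h5 := hbound (n + 1)
      have h6 : r * |S (n + 1)| ≤ 1 * |S (n + 1)| := by gcongr
      push_cast at h4 h5
      linarith
    calc _ ≤ r ^ n * ((2 * n + 3) * Real.pi) := by gcongr
      _ = _ := by ring
  simp_rw [hD] at hlim
  have h0 : S 2 - r * S 1 = 0 := tendsto_nhds_unique tendsto_const_nhds hlim
  have hS0 : S 0 = 0 := by simp [hS, sineKernel]
  have h2 := hrec 0
  rw [if_pos rfl, hS0] at h2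
  change S 1 = _
  simp only [zero_add] at h2
  linear_combination r * h0 - r * h2 - S 1 * hinv

lemma integral_sineKernel {r : ℝ} (hr : 0 < r) (hr1 : r ≤ 1) (n : ℕ) :
    ∫ θ in (0 : ℝ)..Real.pi, sineKernel (r + r⁻¹) (n + 1) θ = Real.pi / 2 * r ^ (n + 1) := by
  have hinv : r * r⁻¹ = 1 := mul_inv_cancel₀ hr.ne'
  have hg := two_le_add_inv hr
  induction n using Nat.twoStepInduction with
  | zero => simpa using integral_sineKernel_one hr hr1
  | one =>
    rw [integral_sineKernel_add_two hg, if_pos rfl, zero_add, integral_sineKernel_one hr hr1]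
    simp only [sineKernel, Nat.cast_zero, zero_mul, Real.sin_zero, mul_zero, zero_div,
      intervalIntegral.integral_zero]
    linear_combination Real.pi / 2 * hinv
  | more n ih₀ ih₁ =>
    rw [integral_sineKernel_add_two hg, if_neg n.succ_ne_zero, ih₀, ih₁]
    linear_combination Real.pi / 2 * r ^ (n + 1) * hinv

/-- The Lebesgue density of the absolutely continuous part of `eta`. -/
noncomputable def etaDensity (c x : ℝ) : ℝ :=
  Real.exp c * Real.sqrt (4 - x ^ 2) * (if |x| < 2 then 1 else 0) /
    (2 * Real.pi * ((Real.exp c + Real.exp (-c)) - x))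

lemma two_le_exp_add_exp_neg (c : ℝ) : 2 ≤ Real.exp c + Real.exp (-c) := by
  rw [Real.exp_neg]
  exact two_le_add_inv (Real.exp_pos c)

lemma etaDensity_eq_zero {c x : ℝ} (hx : ¬|x| < 2) : etaDensity c x = 0 := by
  simp [etaDensity, hx]

lemma etaDensity_nonneg (c x : ℝ) : 0 ≤ etaDensity c x := by
  by_cases hx : |x| < 2
  · have h1 := (abs_lt.1 hx).2
    have h2 : 0 ≤ (Real.exp c + Real.exp (-c)) - x := by linarith [two_le_exp_add_exp_neg c]
    rw [etaDensity, if_pos hx]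
    positivity
  · rw [etaDensity_eq_zero hx]

lemma measurable_etaDensity (c : ℝ) : Measurable (etaDensity c) := by
  unfold etaDensity
  have : Measurable fun x : ℝ => if |x| < 2 then (1 : ℝ) else 0 :=
    Measurable.ite (measurableSet_lt (by fun_prop) measurable_const) measurable_const
      measurable_const
  fun_prop

lemma two_mul_sin_mul_etaDensity {c θ : ℝ} (hθ : θ ∈ Set.Icc 0 Real.pi) (n : ℕ) :
    |-(2 * Real.sin θ)| * (etaDensity c (2 * Real.cos θ) * (P n).eval (2 * Real.cos θ)) =
      2 * Real.exp c / Real.pi * sineKernel (Real.exp c + Real.exp (-c)) (n + 1) θ := by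
  have hs : 0 ≤ Real.sin θ := Real.sin_nonneg_of_mem_Icc hθ
  have hsqrt : Real.sqrt (4 - (2 * Real.cos θ) ^ 2) = 2 * Real.sin θ := by
    rw [show 4 - (2 * Real.cos θ) ^ 2 = (2 * Real.sin θ) ^ 2 by
      linear_combination -4 * Real.sin_sq_add_cos_sq θ]
    exact Real.sqrt_sq (by positivity)
  have hite : 2 * Real.sin θ * (if |2 * Real.cos θ| < 2 then 1 else 0) = 2 * Real.sin θ := by
    split_ifs with h
    · rw [mul_one]
    · have h1 : 1 ≤ |Real.cos θ| := by
        rw [abs_mul, abs_two] at h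
        linarith
      have h2 : 1 ≤ Real.cos θ ^ 2 := by rw [← sq_abs]; nlinarith
      have h3 : Real.sin θ = 0 := by
        have := Real.sin_sq_add_cos_sq θ
        exact pow_eq_zero_iff two_ne_zero |>.1 (le_antisymm (by linarith) (sq_nonneg _))
      simp [h3]
  rw [abs_neg, abs_of_nonneg (by positivity), etaDensity, sineKernel, hsqrt, mul_assoc (Real.exp c),
    hite, ← eval_P_two_mul_cos_mul_sin, div_eq_mul_inv, mul_inv, mul_inv]
  ring

lemma image_two_mul_cos : (fun θ => 2 * Real.cos θ) '' Set.Icc 0 Real.pi = Set.Icc (-2) 2 := by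
  rw [← Set.image_image (fun x => 2 * x) Real.cos, Real.bijOn_cos.image_eq,
    Set.image_mul_left_Icc' two_pos]
  norm_num

lemma integrable_and_integral_etaDensity_mul_P (c : ℝ) (n : ℕ) :
    Integrable (fun x => etaDensity c x * (P n).eval x) ∧
    ∫ x, etaDensity c x * (P n).eval x =
      2 * Real.exp c / Real.pi *
        ∫ θ in (0 : ℝ)..Real.pi, sineKernel (Real.exp c + Real.exp (-c)) (n + 1) θ := by
  have hsupp : Function.support (fun x => etaDensity c x * (P n).eval x) ⊆ Set.Icc (-2) 2 := by
    intro x hx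
    by_contra h
    refine hx ?_
    dsimp only
    rw [etaDensity_eq_zero, zero_mul]
    exact fun h' => h (abs_le.1 h'.le)
  have hderiv : ∀ θ ∈ Set.Icc 0 Real.pi, HasDerivWithinAt (fun θ => 2 * Real.cos θ)
      (-(2 * Real.sin θ)) (Set.Icc 0 Real.pi) θ := fun θ _ => by
    simpa using ((Real.hasDerivAt_cos θ).const_mul 2).hasDerivWithinAt
  have hinj : Set.InjOn (fun θ => 2 * Real.cos θ) (Set.Icc 0 Real.pi) := fun x hx y hy h =>
    Real.injOn_cos hx hy (mul_left_cancel₀ two_ne_zero h)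
  constructor
  · rw [← integrableOn_iff_integrable_of_support_subset hsupp, ← image_two_mul_cos,
      integrableOn_image_iff_integrableOn_abs_deriv_smul measurableSet_Icc hderiv hinj]
    refine IntegrableOn.congr_fun (((intervalIntegrable_iff_integrableOn_Icc_of_le
      Real.pi_pos.le).1 (intervalIntegrable_sineKernel (two_le_exp_add_exp_neg c) (n + 1) 0
      Real.pi)).const_mul (2 * Real.exp c / Real.pi)) (fun θ hθ => ?_) measurableSet_Icc
    exact (two_mul_sin_mul_etaDensity hθ n).symm
  · rw [← setIntegral_eq_integral_of_forall_compl_eq_zero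
      (fun x hx => Function.notMem_support.1 fun h => hx (hsupp h)), ← image_two_mul_cos,
      integral_image_eq_integral_abs_deriv_smul measurableSet_Icc hderiv hinj]
    simp only [smul_eq_mul]
    rw [setIntegral_congr_fun measurableSet_Icc (fun θ hθ => two_mul_sin_mul_etaDensity hθ n),
      integral_const_mul, integral_Icc_eq_integral_Ioc,
      ← intervalIntegral.integral_of_le Real.pi_pos.le]

lemma integral_P_eta (c : ℝ) (n : ℕ) :
    ∫ x, (P n).eval x ∂(eta c) = Real.exp (-(c * n)) := by
  obtain ⟨hint, hval⟩ := integrable_and_integral_etaDensity_mul_P c n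
  have hmeas := (measurable_etaDensity c).ennreal_ofReal
  have hlt : ∀ᵐ x : ℝ, ENNReal.ofReal (etaDensity c x) < ⊤ :=
    .of_forall fun _ => ENNReal.ofReal_lt_top
  have hsmul : ∀ x, (ENNReal.ofReal (etaDensity c x)).toReal • (P n).eval x =
      etaDensity c x * (P n).eval x := fun x => by
    rw [ENNReal.toReal_ofReal (etaDensity_nonneg c x), smul_eq_mul]
  have hw0 : 0 ≤ (if c < 0 then (1 : ℝ) else 0) * (1 - Real.exp (2 * c)) := by
    split_ifs with hc
    · have : Real.exp (2 * c) ≤ 1 := Real.exp_le_one_iff.2 (by linarith)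
      linarith
    · simp
  have heta : eta c = ENNReal.ofReal ((if c < 0 then 1 else 0) * (1 - Real.exp (2 * c))) •
      Measure.dirac (Real.exp c + Real.exp (-c)) +
        volume.withDensity fun x => ENNReal.ofReal (etaDensity c x) := rfl
  rw [heta, integral_add_measure
    ((integrable_dirac (by simp)).smul_measure ENNReal.ofReal_ne_top)
    ((integrable_withDensity_iff_integrable_smul' hmeas hlt).2 (by simpa only [hsmul] using hint)),
    integral_smul_measure, integral_dirac, integral_withDensity_eq_integral_toReal_smul hmeas hlt]
  simp_rw [hsmul]
  rw [hval, ENNReal.toReal_ofReal hw0, smul_eq_mul, show -(c * n) = n * (-c) by ring,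
    Real.exp_nat_mul]
  have hpi := Real.pi_ne_zero
  have hexp : Real.exp c * Real.exp (-c) = 1 := by rw [← Real.exp_add, add_neg_cancel, Real.exp_zero]
  rcases lt_or_ge c 0 with hc | hc
  · have hP := eval_P_add_inv_mul (Real.exp_pos c).ne' n
    have hS := integral_sineKernel (Real.exp_pos c) (Real.exp_le_one_iff.2 hc.le) n
    rw [← Real.exp_neg] at hP hS
    rw [hS, if_pos hc, two_mul, Real.exp_add]
    field_simp
    linear_combination Real.exp c * hP +
      (Real.exp (-c) ^ n - (P n).eval (Real.exp c + Real.exp (-c))) * hexp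
  · have hS := integral_sineKernel (Real.exp_pos (-c)) (Real.exp_le_one_iff.2 (by linarith)) n
    rw [← Real.exp_neg, neg_neg, add_comm] at hS
    rw [hS, if_neg hc.not_gt]
    field_simp
    linear_combination Real.exp (-c) ^ n * hexp

/-- `η_c` is a probability measure with moments `∫ P_n dη_c = e^{-cn}`. -/
theorem eta_moments (c : ℝ) (n : ℕ) :
    IsProbabilityMeasure (eta c) ∧
    (∫ x, (P n).eval x ∂(eta c)) = Real.exp (-(c * n)) := by
  refine ⟨⟨?_⟩, integral_P_eta c n⟩
  have h := integral_P_eta c 0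
  simp only [P, Polynomial.eval_one, integral_const, smul_eq_mul, mul_one, Nat.cast_zero, mul_zero,
    neg_zero, Real.exp_zero, measureReal_def] at h
  exact (ENNReal.toReal_eq_one_iff _).1 h
end

section
/- For each N ∈ ℕ let d_N : ℝ → ℝ be antitone (non-increasing), let (t_N), (t'_N) be real sequences and (s_N) a sequence of positive reals, and let f : ℝ → ℝ satisfy f(c) < f(0) for every c > 0 and f(c) > f(0) for every c < 0. Assume that d_N(t_N + c·s_N) → f(c) as N → ∞ for every c ∈ ℝ, and that d_N(t'_N) → f(0) as N → ∞. Then (t'_N − t_N)/s_N → 0 as N → ∞. -/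
open Filter

/-- If the antitone distance functions `d_N` converge to a profile `f` along the time scale
`t_N + c·s_N`, and `d_N(t'_N) → f(0)`, then `(t'_N - t_N)/s_N → 0`. -/
theorem cutoff_time_unique (d : ℕ → ℝ → ℝ) (hd : ∀ N, Antitone (d N))
    (t t' : ℕ → ℝ) (s : ℕ → ℝ) (hs : ∀ N, 0 < s N)
    (f : ℝ → ℝ) (hf_pos : ∀ c > 0, f c < f 0) (hf_neg : ∀ c < 0, f 0 < f c)
    (hconv : ∀ c : ℝ,
      Tendsto (fun N => d N (t N + c * s N)) atTop (nhds (f c)))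
    (hconv' : Tendsto (fun N => d N (t' N)) atTop (nhds (f 0))) :
    Tendsto (fun N => (t' N - t N) / s N) atTop (nhds 0) := by
  refine tendsto_order.2 ⟨fun c hc => ?_, fun c hc => ?_⟩
  · filter_upwards [hconv'.eventually_lt (hconv c) (hf_neg c hc)] with N hN
    rw [lt_div_iff₀ (hs N)]
    linarith [(hd N).reflect_lt hN]
  · filter_upwards [(hconv c).eventually_lt hconv' (hf_pos c hc)] with N hN
    rw [div_lt_iff₀ (hs N)]
    linarith [(hd N).reflect_lt hN]
end

section
/- For each N ∈ ℕ let d_N : ℝ → ℝ be antitone (non-increasing), let (t_N), (t'_N) be real sequences and (s_N), (s'_N) sequences of positive reals, and let f, f' : ℝ → ℝ be continuous strictly decreasing functions with f(0) = f'(0) and f(1) = f'(1). Assume that for every c ∈ ℝ, d_N(t_N + c·s_N) → f(c) and d_N(t'_N + c·s'_N) → f'(c) as N → ∞. Then (t'_N − t_N)/s_N → 0, s'_N/s_N → 1, and f = f'. In other words, a limit profile is unique up to this normalization. -/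
open Filter

/-- Along `t + c * s`, the rescaled position of a sequence `x` along which `d` converges to
`f a` must converge to `a`. -/
theorem tendsto_rescaled_of_tendsto_profile {d : ℕ → ℝ → ℝ} (hd : ∀ N, Antitone (d N))
    {t s x : ℕ → ℝ} (hs : ∀ N, 0 < s N) {f : ℝ → ℝ} (hf : StrictAnti f)
    (hconv : ∀ c : ℝ, Tendsto (fun N => d N (t N + c * s N)) atTop (nhds (f c)))
    {a : ℝ} (hx : Tendsto (fun N => d N (x N)) atTop (nhds (f a))) :
    Tendsto (fun N => (x N - t N) / s N) atTop (nhds a) := by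
  refine tendsto_order.2 ⟨fun b hb => ?_, fun b hb => ?_⟩
  · filter_upwards [hx.eventually_lt (hconv b) (hf hb)] with N hN
    have := (hd N).reflect_lt hN
    rw [lt_div_iff₀ (hs N)]
    linarith
  · filter_upwards [(hconv b).eventually_lt hx (hf hb)] with N hN
    have := (hd N).reflect_lt hN
    rw [div_lt_iff₀ (hs N)]
    linarith

/-- Conversely, if the rescaled position of `x` converges to `a` and `d` converges along `x`,
then its limit is the value at `a` of the continuous profile. -/
theorem eq_profile_of_tendsto_rescaled {d : ℕ → ℝ → ℝ} (hd : ∀ N, Antitone (d N))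
    {t s x : ℕ → ℝ} (hs : ∀ N, 0 < s N) {f : ℝ → ℝ} (hf : Continuous f)
    (hconv : ∀ c : ℝ, Tendsto (fun N => d N (t N + c * s N)) atTop (nhds (f c)))
    {a l : ℝ} (hx : Tendsto (fun N => d N (x N)) atTop (nhds l))
    (ha : Tendsto (fun N => (x N - t N) / s N) atTop (nhds a)) : f a = l := by
  apply le_antisymm
  · refine le_of_tendsto (hf.continuousWithinAt (s := Set.Ioi a) (x := a)) ?_
    filter_upwards [self_mem_nhdsWithin] with b hb
    refine le_of_tendsto_of_tendsto (hconv b) hx ?_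
    filter_upwards [ha.eventually_lt_const hb] with N hN
    rw [div_lt_iff₀ (hs N)] at hN
    exact hd N (by linarith)
  · refine ge_of_tendsto (hf.continuousWithinAt (s := Set.Iio a) (x := a)) ?_
    filter_upwards [self_mem_nhdsWithin] with b hb
    refine le_of_tendsto_of_tendsto hx (hconv b) ?_
    filter_upwards [ha.eventually_const_lt hb] with N hN
    rw [lt_div_iff₀ (hs N)] at hN
    exact hd N (by linarith)

/-- Uniqueness of the limit profile: if the antitone distance functions `d_N` admit the
continuous strictly decreasing limit profiles `f` and `f'` along the time scales `(t_N, s_N)`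
and `(t'_N, s'_N)` respectively, and `f`, `f'` agree at `0` and `1`, then
`(t'_N - t_N)/s_N → 0`, `s'_N/s_N → 1` and `f = f'`. -/
theorem limit_profile_unique (d : ℕ → ℝ → ℝ) (hd : ∀ N, Antitone (d N))
    (t t' : ℕ → ℝ) (s s' : ℕ → ℝ) (hs : ∀ N, 0 < s N) (hs' : ∀ N, 0 < s' N)
    (f f' : ℝ → ℝ) (hf_cont : Continuous f) (hf'_cont : Continuous f')
    (hf_anti : StrictAnti f) (hf'_anti : StrictAnti f')
    (h0 : f 0 = f' 0) (h1 : f 1 = f' 1)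
    (hconv : ∀ c : ℝ,
      Tendsto (fun N => d N (t N + c * s N)) atTop (nhds (f c)))
    (hconv' : ∀ c : ℝ,
      Tendsto (fun N => d N (t' N + c * s' N)) atTop (nhds (f' c))) :
    Tendsto (fun N => (t' N - t N) / s N) atTop (nhds 0) ∧
    Tendsto (fun N => s' N / s N) atTop (nhds 1) ∧
    f = f' := by
  have hshift : Tendsto (fun N => (t' N - t N) / s N) atTop (nhds 0) := by
    have h := tendsto_rescaled_of_tendsto_profile hd hs hf_anti hconv (h0 ▸ hconv' 0)
    simpa using h
  have hscale : Tendsto (fun N => s' N / s N) atTop (nhds 1) := by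
    have h := (tendsto_rescaled_of_tendsto_profile hd hs hf_anti hconv (h1 ▸ hconv' 1)).sub hshift
    rw [sub_zero] at h
    refine h.congr fun N => ?_
    ring
  refine ⟨hshift, hscale, funext fun c => ?_⟩
  refine eq_profile_of_tendsto_rescaled hd hs hf_cont hconv (hconv' c) ?_
  have h := hshift.add (hscale.const_mul c)
  rw [zero_add, mul_one] at h
  refine h.congr fun N => ?_
  ring
end
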